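/- Let n ≥ 2 be an integer and 1 ≤ r ≤ n. For a uniformly random permutation σ of {1,…,n}, the probability that the threshold strategy with cutoff r succeeds in the Postdoc problem equals r(n−r)/(n(n−1)), i.e., exactly half of the success probability 2r(n−r)/(n(n−1)) of the threshold strategy with the same cutoff in the Best-or-Worst problem. -/

import Mathlib

open scoped Classical

/-- Position `j` is a BW-record: `σ j` is a maximum or a minimum of the values
inspected so far. -/
def bwRecord {n : ℕ} (σ : Equiv.Perm (Fin n)) (j : Fin n) : Prop :=
  (∀ i ≤ j, σ i ≤ σ j) ∨ (∀ i ≤ j, σ j ≤ σ i)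

/-- Position `j` is a PD-record: `σ j` is the second largest among the values
inspected so far (exactly one position `i ≤ j` carries a strictly larger value). -/
def pdRecord {n : ℕ} (σ : Equiv.Perm (Fin n)) (j : Fin n) : Prop :=
  ((Finset.Iic j).filter (fun i => σ j < σ i)).card = 1

/-- Success of the cutoff-`r` threshold strategy in the Best-or-Worst problem:
the first BW-record of 1-based position `> r` carries the overall best (`n-1`)
or worst (`0`) object. -/
def bwSuccess (n r : ℕ) (σ : Equiv.Perm (Fin n)) : Prop :=
  ∃ j : Fin n, r ≤ (j : ℕ) ∧ bwRecord σ j ∧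
    (∀ i : Fin n, r ≤ (i : ℕ) → i < j → ¬ bwRecord σ i) ∧
    ((σ j : ℕ) = 0 ∨ (σ j : ℕ) = n - 1)

/-- Success of the cutoff-`r` threshold strategy in the Postdoc problem:
the first PD-record of 1-based position `> r` carries the overall second best
object (value `n-2`). -/
def pdSuccess (n r : ℕ) (σ : Equiv.Perm (Fin n)) : Prop :=
  ∃ j : Fin n, r ≤ (j : ℕ) ∧ pdRecord σ j ∧
    (∀ i : Fin n, r ≤ (i : ℕ) → i < j → ¬ pdRecord σ i) ∧
    (σ j : ℕ) = n - 2

/-- The permutation of `Fin (n + 1)` whose last value is `v` and whose other values are in the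
same relative order as those of `τ`. -/
def insertLast {n : ℕ} (v : Fin (n + 1)) (τ : Equiv.Perm (Fin n)) : Equiv.Perm (Fin (n + 1)) :=
  (finSuccEquiv' (Fin.last n)).trans ((Equiv.optionCongr τ).trans (finSuccEquiv' v).symm)

@[simp]
theorem insertLast_castSucc {n : ℕ} (v : Fin (n + 1)) (τ : Equiv.Perm (Fin n)) (i : Fin n) :
    insertLast v τ i.castSucc = v.succAbove (τ i) := by
  rw [← Fin.succAbove_last_apply]
  simp [insertLast, -Fin.succAbove_last]

@[simp]
theorem insertLast_last {n : ℕ} (v : Fin (n + 1)) (τ : Equiv.Perm (Fin n)) :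
    insertLast v τ (Fin.last n) = v := by
  simp [insertLast]

theorem insertLast_bijective (n : ℕ) :
    Function.Bijective fun p : Fin (n + 1) × Equiv.Perm (Fin n) ↦ insertLast p.1 p.2 := by
  rw [Fintype.bijective_iff_injective_and_card]
  constructor
  · rintro ⟨v, τ⟩ ⟨w, ρ⟩ h
    have hv : v = w := by simpa using DFunLike.congr_fun h (Fin.last n)
    subst hv
    have hτ : τ = ρ := by
      ext i : 1
      simpa using DFunLike.congr_fun h i.castSucc
    rw [hτ]
  · simp [Fintype.card_perm, Nat.factorial_succ]

/-- Counting permutations of `Fin (n + 1)` according to their last value. -/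
theorem card_filter_perm_succ {n : ℕ} (P : Equiv.Perm (Fin (n + 1)) → Prop) :
    (Finset.univ.filter P).card =
      ∑ v : Fin (n + 1), (Finset.univ.filter fun τ ↦ P (insertLast v τ)).card := by
  simp only [Finset.card_filter]
  rw [← Fintype.sum_prod_type' (fun v τ ↦ if P (insertLast v τ) then 1 else 0)]
  exact ((insertLast_bijective n).sum_comp fun σ ↦ if P σ then 1 else 0).symm

/-- The number of positions up to `j` carrying a value larger than `σ j`. -/
def numAbove {n : ℕ} (σ : Equiv.Perm (Fin n)) (j : Fin n) : ℕ :=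
  ((Finset.Iic j).filter fun i ↦ σ j < σ i).card

@[simp]
theorem numAbove_insertLast_castSucc {n : ℕ} (v : Fin (n + 1)) (τ : Equiv.Perm (Fin n))
    (j : Fin n) : numAbove (insertLast v τ) j.castSucc = numAbove τ j := by
  unfold numAbove
  rw [← Finset.card_map (s := (Finset.Iic j).filter _) Fin.castSuccEmb]
  congr 1
  ext i
  induction i using Fin.lastCases with
  | last => simp [Fin.castSucc_ne_last]
  | cast i => simp

@[simp]
theorem numAbove_insertLast_last {n : ℕ} (v : Fin (n + 1)) (τ : Equiv.Perm (Fin n)) :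
    numAbove (insertLast v τ) (Fin.last n) = n - v := by
  have h : (Finset.Ioi v).map (insertLast v τ).symm.toEmbedding =
      (Finset.Iic (Fin.last n)).filter
        fun i ↦ insertLast v τ (Fin.last n) < insertLast v τ i := by
    ext i
    simp [Finset.mem_map_equiv, Fin.le_last]
  rw [numAbove, ← h, Finset.card_map, Fin.card_Ioi]
  omega

/-- No position `i ≥ r` is a record, where `i` is a record when `Q i (numAbove σ i)` holds. -/
def NoRecordFrom (Q : ℕ → ℕ → Prop) (r : ℕ) {n : ℕ} (σ : Equiv.Perm (Fin n)) : Prop :=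
  ∀ i : Fin n, r ≤ (i : ℕ) → ¬ Q i (numAbove σ i)

/-- The first record at a position `j ≥ r` exists and has value `t`, where `i` is a record when
`Q i (numAbove σ i)` holds. -/
def FirstRecordFrom (Q : ℕ → ℕ → Prop) (r t : ℕ) {n : ℕ} (σ : Equiv.Perm (Fin n)) : Prop :=
  ∃ j : Fin n, r ≤ (j : ℕ) ∧ Q j (numAbove σ j) ∧
    (∀ i : Fin n, r ≤ (i : ℕ) → i < j → ¬ Q i (numAbove σ i)) ∧ (σ j : ℕ) = t

theorem noRecordFrom_insertLast {Q : ℕ → ℕ → Prop} {r n : ℕ} (hr : r ≤ n) (v : Fin (n + 1))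
    (τ : Equiv.Perm (Fin n)) :
    NoRecordFrom Q r (insertLast v τ) ↔ ¬ Q n (n - v) ∧ NoRecordFrom Q r τ := by
  simp [NoRecordFrom, Fin.forall_fin_succ', hr, and_comm]

theorem firstRecordFrom_insertLast {Q : ℕ → ℕ → Prop} {r t n : ℕ} (hr : r ≤ n) (v : Fin (n + 1))
    (τ : Equiv.Perm (Fin n)) :
    FirstRecordFrom Q r t (insertLast v τ) ↔
      (v : ℕ) = t ∧ Q n (n - v) ∧ NoRecordFrom Q r τ ∨
      (v : ℕ) < t ∧ FirstRecordFrom Q r (t - 1) τ ∨ t < v ∧ FirstRecordFrom Q r t τ := by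
  have hval : ∀ j : Fin n, (v.succAbove (τ j) : ℕ) = t ↔
      (v : ℕ) < t ∧ (τ j : ℕ) = t - 1 ∨ t < v ∧ (τ j : ℕ) = t := by
    intro j
    rcases lt_or_ge (τ j).castSucc v with h | h
    · rw [Fin.succAbove_of_castSucc_lt _ _ h]
      simp only [Fin.lt_def, Fin.val_castSucc] at h ⊢
      omega
    · rw [Fin.succAbove_of_le_castSucc _ _ h]
      simp only [Fin.le_def, Fin.val_castSucc, Fin.val_succ] at h ⊢
      omega
  simp only [FirstRecordFrom, NoRecordFrom, Fin.exists_fin_succ', Fin.forall_fin_succ',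
    numAbove_insertLast_castSucc, numAbove_insertLast_last, insertLast_castSucc, insertLast_last,
    hval, Fin.val_castSucc, Fin.val_last, Fin.castSucc_lt_castSucc_iff, Fin.castSucc_lt_last,
    hr, lt_irrefl, (Fin.castSucc_lt_last _).not_gt, true_and, false_imp_iff,
    and_true, forall_true_left]
  constructor
  · rintro (⟨j, h₁, h₂, h₃, h₄ | h₄⟩ | h)
    · exact .inr (.inl ⟨h₄.1, j, h₁, h₂, h₃, h₄.2⟩)
    · exact .inr (.inr ⟨h₄.1, j, h₁, h₂, h₃, h₄.2⟩)
    · exact .inl ⟨h.2.2, h.1, h.2.1⟩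
  · rintro (h | ⟨h, j, h₁, h₂, h₃, h₄⟩ | ⟨h, j, h₁, h₂, h₃, h₄⟩)
    · exact .inr ⟨h.2.1, h.2.2, h.1⟩
    · exact .inl ⟨j, h₁, h₂, h₃, .inl ⟨h, h₄⟩⟩
    · exact .inl ⟨j, h₁, h₂, h₃, .inr ⟨h, h₄⟩⟩

/-- The number of permutations of `Fin n` without a record at a position `≥ r`. -/
noncomputable def noRecordCount (Q : ℕ → ℕ → Prop) (r n : ℕ) : ℕ :=
  (Finset.univ.filter fun σ : Equiv.Perm (Fin n) ↦ NoRecordFrom Q r σ).card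

/-- The number of permutations of `Fin n` whose first record at a position `≥ r` has value `t`. -/
noncomputable def firstRecordCount (Q : ℕ → ℕ → Prop) (r t n : ℕ) : ℕ :=
  (Finset.univ.filter fun σ : Equiv.Perm (Fin n) ↦ FirstRecordFrom Q r t σ).card

theorem noRecordCount_self (Q : ℕ → ℕ → Prop) (r : ℕ) : noRecordCount Q r r = r.factorial := by
  have h : ∀ σ : Equiv.Perm (Fin r), NoRecordFrom Q r σ := fun σ i hi ↦ absurd i.isLt hi.not_gt
  simp [noRecordCount, h, Fintype.card_perm]

theorem firstRecordCount_self (Q : ℕ → ℕ → Prop) (r t : ℕ) : firstRecordCount Q r t r = 0 := by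
  simp only [firstRecordCount, Finset.card_eq_zero, Finset.filter_eq_empty_iff]
  rintro σ - ⟨j, hj, -⟩
  exact absurd j.isLt hj.not_gt

theorem noRecordCount_succ (Q : ℕ → ℕ → Prop) {r n : ℕ} (hr : r ≤ n) :
    noRecordCount Q r (n + 1) =
      ((Finset.range (n + 1)).filter fun a ↦ ¬ Q n a).card * noRecordCount Q r n := by
  have h : ∀ v : Fin (n + 1),
      (Finset.univ.filter fun τ ↦ NoRecordFrom Q r (insertLast v τ)).card =
        if ¬ Q n (n - v) then noRecordCount Q r n else 0 := by
    intro v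
    simp only [noRecordFrom_insertLast hr]
    split_ifs with hQ <;> simp [hQ, noRecordCount]
  rw [noRecordCount, card_filter_perm_succ, Finset.sum_congr rfl fun v _ ↦ h v,
    Fin.sum_univ_eq_sum_range (fun v ↦ if ¬ Q n (n - v) then noRecordCount Q r n else 0),
    Finset.sum_flip (fun a ↦ if ¬ Q n a then noRecordCount Q r n else 0), ← Finset.sum_filter,
    Finset.sum_const, smul_eq_mul]

theorem firstRecordCount_succ (Q : ℕ → ℕ → Prop) {r t n : ℕ} (hr : r ≤ n) (ht : t ≤ n)
    (hQ : Q n (n - t)) :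
    firstRecordCount Q r t (n + 1) = noRecordCount Q r n +
      t * firstRecordCount Q r (t - 1) n + (n - t) * firstRecordCount Q r t n := by
  have h : ∀ v : Fin (n + 1),
      (Finset.univ.filter fun τ ↦ FirstRecordFrom Q r t (insertLast v τ)).card =
        if (v : ℕ) < t then firstRecordCount Q r (t - 1) n
        else if (v : ℕ) = t then noRecordCount Q r n else firstRecordCount Q r t n := by
    intro v
    simp only [firstRecordFrom_insertLast hr]
    rcases lt_trichotomy (v : ℕ) t with hv | hv | hv
    · simp [hv, hv.ne, hv.not_gt, firstRecordCount]
    · simp [hv, hQ, noRecordCount]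
    · simp [hv, hv.ne', hv.not_gt, firstRecordCount]
  obtain ⟨k, rfl⟩ := Nat.exists_eq_add_of_le ht
  rw [firstRecordCount, card_filter_perm_succ, Finset.sum_congr rfl fun v _ ↦ h v,
    Fin.sum_univ_eq_sum_range (fun v ↦ if v < t then firstRecordCount Q r (t - 1) (t + k)
        else if v = t then noRecordCount Q r (t + k) else firstRecordCount Q r t (t + k)),
    add_assoc, Finset.sum_range_add, Finset.sum_range_succ',
    Finset.sum_congr rfl fun v hv ↦ if_pos (Finset.mem_range.1 hv)]
  simp
  ring

theorem firstRecordCount_eq_zero {Q : ℕ → ℕ → Prop} {r t n : ℕ} (ht : n ≤ t + 1)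
    (hQ : ∀ j, ¬ Q j 0) : firstRecordCount Q r t n = 0 := by
  simp only [firstRecordCount, Finset.card_eq_zero, Finset.filter_eq_empty_iff]
  rintro σ - ⟨j, -, hj, -, hjt⟩
  refine hQ j ?_
  convert hj
  rw [eq_comm, numAbove, Finset.card_eq_zero, Finset.filter_eq_empty_iff]
  intro i _
  rw [Fin.lt_def]
  omega

/-- The counts for the Postdoc problem. -/
theorem postdoc_counts {r n : ℕ} (hr : 1 ≤ r) (hrn : r ≤ n) :
    noRecordCount (fun _ a ↦ a = 1) r n = r * (n - 1).factorial ∧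
      firstRecordCount (fun _ a ↦ a = 1) r (n - 2) n = r * (n - r) * (n - 2).factorial := by
  induction n, hrn using Nat.le_induction with
  | base =>
    rw [noRecordCount_self, firstRecordCount_self, Nat.mul_factorial_pred (by omega)]
    simp
  | succ n hrn ih =>
    obtain ⟨m, rfl⟩ : ∃ m, n = m + 1 := ⟨n - 1, by omega⟩
    obtain ⟨ih₁, ih₂⟩ := ih
    have hcard : ((Finset.range (m + 1 + 1)).filter fun a ↦ ¬ a = 1).card = m + 1 := by
      rw [Finset.filter_ne', Finset.card_erase_of_mem (by simp), Finset.card_range]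
      rfl
    obtain ⟨k, hk⟩ := Nat.exists_eq_add_of_le hrn
    refine ⟨?_, ?_⟩
    · have h := noRecordCount_succ (fun _ a ↦ a = 1) hrn
      rw [ih₁] at h
      convert h using 1
      rw [show Finset.card _ = m + 1 by convert hcard]
      simp [Nat.factorial_succ]
      ring
    · rw [firstRecordCount_succ _ hrn (by omega) (by omega), ih₁,
        firstRecordCount_eq_zero (t := m + 1 + 1 - 2) (by omega) (by simp)]
      rw [show m + 1 + 1 - 2 - 1 = m + 1 - 2 by omega, ih₂, show m + 1 + 1 - r = k + 1 by omega,
        show m + 1 - r = k by omega]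
      rcases m with _ | m
      · obtain rfl : k = 0 := by omega
        simp
      · simp [Nat.factorial_succ]
        ring

/-- The predicate on `numAbove` describing best-or-worst records. -/
abbrev bwRank (j a : ℕ) : Prop := a = 0 ∨ a = j

theorem noRecordCount_bwRank_succ {r n : ℕ} (hn : 1 ≤ n) (hrn : r ≤ n) :
    noRecordCount bwRank r (n + 1) = (n - 1) * noRecordCount bwRank r n := by
  rw [noRecordCount_succ _ hrn]
  congr 1
  have : (Finset.range (n + 1)).filter (fun a ↦ ¬ bwRank n a) = Finset.Ioo 0 n := by
    ext a
    simp [bwRank]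
    omega
  trans (Finset.Ioo 0 n).card
  · rw [← this]
    congr!
  · rw [Nat.card_Ioo]
    omega

theorem noRecordCount_bwRank {r m : ℕ} (hr : 1 ≤ r) (hrn : r ≤ m + 2) :
    noRecordCount bwRank r (m + 2) = r * (r - 1) * m.factorial := by
  induction m with
  | zero =>
    obtain rfl | rfl : r = 1 ∨ r = 2 := by omega
    · simp [noRecordCount_bwRank_succ]
    · simp [noRecordCount_self]
  | succ m ih =>
    rcases eq_or_lt_of_le hrn with rfl | h
    · rw [noRecordCount_self]
      simp [Nat.factorial_succ]
      ring
    · rw [noRecordCount_bwRank_succ (by omega) (by omega), ih (by omega)]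
      simp [Nat.factorial_succ]
      ring

/-- Any recursion of the shape satisfied by the best-or-worst success counts has this solution. -/
theorem eq_of_bw_recursion {r : ℕ} (hr : 1 ≤ r) {S : ℕ → ℕ} (h0 : S r = 0)
    (hS : ∀ n, r ≤ n → S (n + 1) = noRecordCount bwRank r n + n * S n) {n : ℕ} (hrn : r ≤ n) :
    S n = r * (n - r) * (n - 2).factorial := by
  induction n, hrn using Nat.le_induction with
  | base => simp [h0]
  | succ n hrn ih =>
    rw [hS n hrn, ih]
    rcases n with _ | _ | m
    · omega
    · obtain rfl : r = 1 := by omega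
      simp [noRecordCount_self]
    · rw [noRecordCount_bwRank hr hrn]
      obtain ⟨k, hk⟩ := Nat.exists_eq_add_of_le hrn
      obtain ⟨s, rfl⟩ := Nat.exists_eq_add_of_le' hr
      rw [show m + 1 + 1 - (s + 1) = k by omega, show m + 1 + 1 + 1 - (s + 1) = k + 1 by omega]
      have h : (m + 1 + 1) * k + s = (m + 1) * (k + 1) := by
        rw [show m + 1 = s + k by omega]
        ring
      calc (s + 1) * s * m.factorial + (m + 1 + 1) * ((s + 1) * k * m.factorial)
          = (s + 1) * m.factorial * ((m + 1 + 1) * k + s) := by ring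
        _ = (s + 1) * (k + 1) * ((m + 1) * m.factorial) := by rw [h]; ring

theorem firstRecordCount_bwRank_max {r n : ℕ} (hr : 1 ≤ r) (hrn : r ≤ n) :
    firstRecordCount bwRank r (n - 1) n = r * (n - r) * (n - 2).factorial := by
  refine eq_of_bw_recursion hr (S := fun n ↦ firstRecordCount bwRank r (n - 1) n)
    (firstRecordCount_self _ _ _) (fun n hn ↦ ?_) hrn
  simpa using firstRecordCount_succ bwRank hn le_rfl (by simp [bwRank])

theorem firstRecordCount_bwRank_min {r n : ℕ} (hr : 1 ≤ r) (hrn : r ≤ n) :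
    firstRecordCount bwRank r 0 n = r * (n - r) * (n - 2).factorial := by
  refine eq_of_bw_recursion hr (S := firstRecordCount bwRank r 0)
    (firstRecordCount_self _ _ _) (fun n hn ↦ ?_) hrn
  simpa using firstRecordCount_succ bwRank hn (Nat.zero_le n) (by simp [bwRank])

theorem bwRecord_iff {n : ℕ} (σ : Equiv.Perm (Fin n)) (j : Fin n) :
    bwRecord σ j ↔ bwRank j (numAbove σ j) := by
  refine or_congr ?_ ?_
  · simp [numAbove, Finset.filter_eq_empty_iff]
  · have hsub : ((Finset.Iic j).filter fun i ↦ σ j < σ i) ⊆ Finset.Iio j := by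
      intro i hi
      simp only [Finset.mem_filter, Finset.mem_Iic, Finset.mem_Iio] at hi ⊢
      exact lt_of_le_of_ne hi.1 (by rintro rfl; exact lt_irrefl _ hi.2)
    constructor
    · intro h
      rw [numAbove, ← Fin.card_Iio j]
      congr 1
      refine hsub.antisymm fun i hi ↦ ?_
      have hij := Finset.mem_Iio.1 hi
      exact Finset.mem_filter.2 ⟨Finset.mem_Iic.2 hij.le,
        lt_of_le_of_ne (h i hij.le) (σ.injective.ne hij.ne')⟩
    · intro h i hi
      have heq := Finset.eq_of_subset_of_card_le hsub (by rw [Fin.card_Iio]; exact h.ge)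
      rcases hi.eq_or_lt with rfl | hi
      · exact le_rfl
      · exact (Finset.mem_filter.1 (heq ▸ Finset.mem_Iio.2 hi)).2.le

theorem bwSuccess_iff {n r : ℕ} (σ : Equiv.Perm (Fin n)) :
    bwSuccess n r σ ↔ FirstRecordFrom bwRank r 0 σ ∨ FirstRecordFrom bwRank r (n - 1) σ := by
  simp only [bwSuccess, FirstRecordFrom, bwRecord_iff, ← exists_or, ← and_or_left]

theorem FirstRecordFrom.target_unique {Q : ℕ → ℕ → Prop} {r s t n : ℕ} {σ : Equiv.Perm (Fin n)}
    (hs : FirstRecordFrom Q r s σ) (ht : FirstRecordFrom Q r t σ) : s = t := by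
  obtain ⟨i, hi, hQi, hi', rfl⟩ := hs
  obtain ⟨j, hj, hQj, hj', rfl⟩ := ht
  rcases lt_trichotomy i j with h | rfl | h
  · exact absurd hQi (hj' i hi h)
  · rfl
  · exact absurd hQj (hi' j hj h)

theorem card_pdSuccess {n r : ℕ} (hr : 1 ≤ r) (hrn : r ≤ n) :
    (Finset.univ.filter (pdSuccess n r)).card = r * (n - r) * (n - 2).factorial :=
  (postdoc_counts hr hrn).2

theorem card_bwSuccess {n r : ℕ} (hn : 2 ≤ n) (hr : 1 ≤ r) (hrn : r ≤ n) :
    (Finset.univ.filter (bwSuccess n r)).card = 2 * (r * (n - r) * (n - 2).factorial) := by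
  have hdisj : Disjoint
      (Finset.univ.filter fun σ : Equiv.Perm (Fin n) ↦ FirstRecordFrom bwRank r 0 σ)
      (Finset.univ.filter fun σ ↦ FirstRecordFrom bwRank r (n - 1) σ) :=
    Finset.disjoint_filter.2 fun σ _ h₁ h₂ ↦ by
      have := h₁.target_unique h₂
      omega
  rw [Finset.filter_congr fun σ _ ↦ bwSuccess_iff σ, Finset.filter_or,
    Finset.card_union_of_disjoint hdisj]
  change firstRecordCount bwRank r 0 n + firstRecordCount bwRank r (n - 1) n = _
  rw [firstRecordCount_bwRank_min hr hrn, firstRecordCount_bwRank_max hr hrn, two_mul]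

/-- For `n ≥ 2` and `1 ≤ r ≤ n`, for a uniformly random permutation
of `{1,…,n}`, the probability of success of the cutoff-`r` threshold strategy in the
Postdoc problem equals `r(n-r)/(n(n-1))`, i.e. exactly half of the success
probability of the cutoff-`r` threshold strategy in the Best-or-Worst problem. -/
theorem stmt_3 (n r : ℕ) (hn : 2 ≤ n) (hr1 : 1 ≤ r) (hrn : r ≤ n) :
    ((Finset.univ.filter (pdSuccess n r)).card : ℚ) / (Nat.factorial n : ℚ)
      = (r : ℚ) * ((n : ℚ) - (r : ℚ)) / ((n : ℚ) * ((n : ℚ) - 1)) ∧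
    ((Finset.univ.filter (bwSuccess n r)).card : ℚ) / (Nat.factorial n : ℚ)
      = 2 * (((Finset.univ.filter (pdSuccess n r)).card : ℚ) / (Nat.factorial n : ℚ)) := by
  obtain ⟨m, rfl⟩ := Nat.exists_eq_add_of_le' hn
  rw [card_pdSuccess hr1 hrn, card_bwSuccess hn hr1 hrn]
  constructor
  · have hm : (m.factorial : ℚ) ≠ 0 := by positivity
    have hm₁ : (m : ℚ) + 2 - 1 ≠ 0 := by
      have : (0 : ℚ) ≤ m := m.cast_nonneg
      linarith
    simp only [Nat.add_sub_cancel, Nat.factorial_succ]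
    push_cast [Nat.cast_sub hrn]
    field_simp
    ring
  · push_cast
    ring
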